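/- Let k ≥ 2. For each n ≥ 1, let T_n be chosen uniformly at random from the (finite, nonempty) set of k-regular trees with exactly n interior nodes, equip each such tree with an arbitrary edge length function ℓ : E → ℝ₊, let C_n be its covariance matrix and Φ_n its Haar-like matrix, and let ζ_n be the fraction of vanishing entries of Φ_n' C_n Φ_n. Then ζ_n → 1 in probability as n → ∞: for every ε > 0, P(ζ_n ≤ 1 − ε) → 0 as n → ∞. -/

import Mathlib

/-- Ordered full `k`-ary plane trees.  A `k`-regular rooted tree (root `∘` of
degree one, every other interior node with exactly `k` ordered children) with
`n` interior nodes corresponds exactly to a `KTree k` with `n - 1` internal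
nodes, namely the subtree hanging from the single child of `∘`.  Vertices of
the plane tree are identified with their positions, i.e. lists over `Fin k`
(the root `∘` of the `k`-regular tree being an extra artificial vertex above
position `[]`), and each non-`∘` vertex is identified with the edge above
it. -/
inductive KTree (k : ℕ) : Type where
  | leaf : KTree k
  | node : (Fin k → KTree k) → KTree k

namespace KTree

variable {k : ℕ}

/-- The number of internal nodes. -/
def numNodes : KTree k → ℕ
  | leaf => 0
  | node f => 1 + ∑ i, numNodes (f i)

/-- The positions of the leaves. -/
def leafPos : KTree k → Finset (List (Fin k))
  | leaf => {[]}
  | node f => Finset.univ.biUnion fun i => (leafPos (f i)).image (List.cons i)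

/-- The positions of the internal nodes. -/
def intPos : KTree k → Finset (List (Fin k))
  | leaf => ∅
  | node f => insert [] (Finset.univ.biUnion fun i => (intPos (f i)).image (List.cons i))

/-- All positions; these correspond to the edges of the `k`-regular tree. -/
def allPos (t : KTree k) : Finset (List (Fin k)) := t.leafPos ∪ t.intPos

/-- The leaves of the subtree rooted at position `w`. -/
def leavesUnder (t : KTree k) (w : List (Fin k)) : Finset (List (Fin k)) :=
  t.leafPos.filter fun l => w <+: l

/-- The phylogenetic covariance matrix: `cov t ℓ i j = ∑_{e ∈ [i∧j, ∘]} ℓ(e)`,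
the edges from the least common ancestor of the leaves `i` and `j` to the
root `∘` being exactly the common prefixes of `i` and `j`. -/
def cov (t : KTree k) (ℓ : List (Fin k) → ℝ) (i j : List (Fin k)) : ℝ :=
  ∑ w ∈ t.allPos.filter (fun w => w <+: i ∧ w <+: j), ℓ w

/-- `L_{w,n}`: the leaves below the first `n` children of the internal node at
position `w`. -/
def Lpart (t : KTree k) (w : List (Fin k)) (n : ℕ) : Finset (List (Fin k)) :=
  t.leafPos.filter fun l => ∃ j : Fin k, (j : ℕ) < n ∧ (w ++ [j]) <+: l

/-- `L(w_{n+1})`: the leaves below the `(n+1)`-st child of the internal node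
at position `w`. -/
def Lnext (t : KTree k) (w : List (Fin k)) (n : ℕ) : Finset (List (Fin k)) :=
  t.leafPos.filter fun l => ∃ j : Fin k, (j : ℕ) = n ∧ (w ++ [j]) <+: l

/-- The Haar-like wavelets, indexed by `none` (the mother wavelet `φ_∘`) and
by `some (w, n)` (the wavelet `φ_{w,n}`). -/
noncomputable def waveFun (t : KTree k) : Option (List (Fin k) × ℕ) → List (Fin k) → ℝ
  | none => fun _ => 1 / Real.sqrt ((t.leafPos.card : ℝ))
  | some (w, n) => fun l =>
      if l ∈ t.Lpart w n then
        Real.sqrt (((t.Lnext w n).card : ℝ) /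
          (((t.Lpart w n).card : ℝ) * ((t.Lpart w n ∪ t.Lnext w n).card : ℝ)))
      else if l ∈ t.Lnext w n then
        - Real.sqrt (((t.Lpart w n).card : ℝ) /
          (((t.Lnext w n).card : ℝ) * ((t.Lpart w n ∪ t.Lnext w n).card : ℝ)))
      else 0

/-- The index set of the Haar-like wavelets (the columns of `Φ`). -/
def waveletIdx (t : KTree k) : Finset (Option (List (Fin k) × ℕ)) :=
  insert none ((t.intPos ×ˢ Finset.Ico 1 k).image some)

/-- The entry of `Φ' C Φ` in row `a` and column `b`. -/
noncomputable def entry (t : KTree k) (ℓ : List (Fin k) → ℝ)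
    (a b : Option (List (Fin k) × ℕ)) : ℝ :=
  ∑ j ∈ t.leafPos, ∑ i ∈ t.leafPos, t.waveFun a j * t.cov ℓ j i * t.waveFun b i

open Classical in
/-- `ζ`: the fraction of vanishing entries of the `|L| × |L|` matrix `Φ' C Φ`. -/
noncomputable def zeta (t : KTree k) (ℓ : List (Fin k) → ℝ) : ℝ :=
  (((t.waveletIdx ×ˢ t.waveletIdx).filter fun p => t.entry ℓ p.1 p.2 = 0).card : ℝ) /
    ((t.leafPos.card : ℝ)) ^ 2


/-! ### Deterministic part -/

theorem sum_leafPos_node (f : Fin k → KTree k) (g : List (Fin k) → ℝ) :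
    ∑ w ∈ (node f).leafPos, g w = ∑ i, ∑ w ∈ (f i).leafPos, g (i :: w) := by
  rw [leafPos, Finset.sum_biUnion]
  · refine Finset.sum_congr rfl fun i _ => ?_
    rw [Finset.sum_image]
    intro a _ b _ h
    simpa using h
  · intro i _ j _ hij
    rw [Function.onFun, Finset.disjoint_left]
    intro a ha hb
    simp only [Finset.mem_image] at ha hb
    obtain ⟨x, _, rfl⟩ := ha
    obtain ⟨y, _, hy⟩ := hb
    simp at hy
    exact hij hy.1.symm

theorem sum_intPos_node (f : Fin k → KTree k) (g : List (Fin k) → ℝ) :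
    ∑ w ∈ (node f).intPos, g w = g [] + ∑ i, ∑ w ∈ (f i).intPos, g (i :: w) := by
  rw [intPos, Finset.sum_insert (by simp), Finset.sum_biUnion]
  · congr 1
    refine Finset.sum_congr rfl fun i _ => ?_
    rw [Finset.sum_image]
    intro a _ b _ h
    simpa using h
  · intro i _ j _ hij
    rw [Function.onFun, Finset.disjoint_left]
    intro a ha hb
    simp only [Finset.mem_image] at ha hb
    obtain ⟨x, _, rfl⟩ := ha
    obtain ⟨y, _, hy⟩ := hb
    simp at hy
    exact hij hy.1.symm

theorem card_intPos (t : KTree k) : (t.intPos.card : ℝ) = t.numNodes := by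
  induction t with
  | leaf => simp [intPos, numNodes]
  | node f ih =>
    have h := sum_intPos_node f (fun _ => (1 : ℝ))
    simp only [Finset.sum_const, nsmul_eq_mul, mul_one] at h
    rw [h, numNodes]
    push_cast
    simp [ih]

theorem card_leafPos (t : KTree k) :
    (t.leafPos.card : ℝ) = 1 + ((k : ℝ) - 1) * t.numNodes := by
  induction t with
  | leaf => simp [leafPos, numNodes]
  | node f ih =>
    have h := sum_leafPos_node f (fun _ => (1 : ℝ))
    simp only [Finset.sum_const, nsmul_eq_mul, mul_one] at h
    rw [h, numNodes]
    push_cast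
    simp only [ih, Finset.sum_add_distrib, ← Finset.mul_sum]
    simp
    ring

theorem length_lt_numNodes (t : KTree k) : ∀ w ∈ t.intPos, w.length < t.numNodes := by
  induction t with
  | leaf => simp [intPos]
  | node f ih =>
    intro w hw
    rw [numNodes]
    simp only [intPos, Finset.mem_insert, Finset.mem_biUnion, Finset.mem_image,
      Finset.mem_univ, true_and] at hw
    rcases hw with rfl | ⟨i, v, hv, rfl⟩
    · simp
    · have h1 := ih i v hv
      have h2 := Finset.single_le_sum (f := fun i => numNodes (f i))
        (fun _ _ => Nat.zero_le _) (Finset.mem_univ i)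
      simp only [List.length_cons]
      omega

theorem card_waveletIdx (hk : 2 ≤ k) (t : KTree k) :
    (t.waveletIdx.card : ℝ) = t.leafPos.card := by
  rw [waveletIdx, Finset.card_insert_of_notMem (by simp),
    Finset.card_image_of_injective _ (Option.some_injective _), Finset.card_product,
    card_leafPos, Nat.card_Ico]
  push_cast [Nat.cast_sub (show 1 ≤ k by omega)]
  rw [card_intPos]
  ring

theorem waveFun_eq_zero (t : KTree k) {w : List (Fin k)} {n : ℕ} {l : List (Fin k)}
    (h : ¬ w <+: l) : t.waveFun (some (w, n)) l = 0 := by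
  have h1 : l ∉ t.Lpart w n := by
    intro hl
    simp only [Lpart, Finset.mem_filter] at hl
    obtain ⟨_, j, _, hj⟩ := hl
    exact h ((List.prefix_append w [j]).trans hj)
  have h2 : l ∉ t.Lnext w n := by
    intro hl
    simp only [Lnext, Finset.mem_filter] at hl
    obtain ⟨_, j, _, hj⟩ := hl
    exact h ((List.prefix_append w [j]).trans hj)
  simp [waveFun, h1, h2]

theorem disj_parts (t : KTree k) (w : List (Fin k)) (n : ℕ) :
    Disjoint (t.Lpart w n) (t.Lnext w n) := by
  rw [Finset.disjoint_left]
  intro l h1 h2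
  simp only [Lpart, Lnext, Finset.mem_filter] at h1 h2
  obtain ⟨_, j, hj, hjl⟩ := h1
  obtain ⟨_, i, hi, hil⟩ := h2
  have := List.prefix_of_prefix_length_le hjl hil (by simp)
  have h3 := this.eq_of_length (by simp)
  simp at h3
  subst h3
  omega

theorem mul_sqrt_aux (a b c : ℝ) (ha : 0 ≤ a) :
    a * Real.sqrt (b / (a * c)) = Real.sqrt (a * b / c) := by
  rcases ha.eq_or_lt with rfl | ha
  · simp
  · nth_rewrite 1 [← Real.sqrt_sq ha.le]
    rw [← Real.sqrt_mul (sq_nonneg a)]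
    congr 1
    by_cases hc : c = 0
    · simp [hc]
    · field_simp

theorem sum_waveFun (t : KTree k) (w : List (Fin k)) (n : ℕ) :
    ∑ l ∈ t.leafPos, t.waveFun (some (w, n)) l = 0 := by
  have hd := disj_parts t w n
  have hsub : t.Lpart w n ∪ t.Lnext w n ⊆ t.leafPos := by
    apply Finset.union_subset <;> exact Finset.filter_subset _ _
  rw [← Finset.sum_subset hsub, Finset.sum_union hd]
  · have e1 : ∀ l ∈ t.Lpart w n, t.waveFun (some (w, n)) l =
        Real.sqrt (((t.Lnext w n).card : ℝ) /
          (((t.Lpart w n).card : ℝ) * ((t.Lpart w n ∪ t.Lnext w n).card : ℝ))) := by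
      intro l hl; simp only [waveFun, hl, if_true]
    have e2 : ∀ l ∈ t.Lnext w n, t.waveFun (some (w, n)) l =
        - Real.sqrt (((t.Lpart w n).card : ℝ) /
          (((t.Lnext w n).card : ℝ) * ((t.Lpart w n ∪ t.Lnext w n).card : ℝ))) := by
      intro l hl
      have : l ∉ t.Lpart w n := fun h => Finset.disjoint_left.1 hd h hl
      simp only [waveFun, hl, this, if_true, if_false]
    rw [Finset.sum_congr rfl e1, Finset.sum_congr rfl e2, Finset.sum_const, Finset.sum_const,
      nsmul_eq_mul, nsmul_eq_mul, mul_neg, mul_sqrt_aux _ _ _ (Nat.cast_nonneg _),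
      mul_sqrt_aux _ _ _ (Nat.cast_nonneg _), mul_comm ((t.Lpart w n).card : ℝ)]
    ring
  · intro l _ hl
    rw [Finset.mem_union, not_or] at hl
    simp only [waveFun, hl.1, hl.2, if_false]

theorem entry_eq_zero (t : KTree k) (ℓ : List (Fin k) → ℝ) (w w' : List (Fin k)) (n n' : ℕ)
    (h1 : ¬ w <+: w') (h2 : ¬ w' <+: w) :
    t.entry ℓ (some (w, n)) (some (w', n')) = 0 := by
  rw [entry]
  refine Finset.sum_eq_zero fun j _ => ?_
  by_cases hj : w <+: j
  · have : ∀ i ∈ t.leafPos,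
        t.waveFun (some (w, n)) j * t.cov ℓ j i * t.waveFun (some (w', n')) i =
        (t.waveFun (some (w, n)) j *
          ∑ v ∈ t.allPos.filter (fun v => v <+: j ∧ v <+: w'), ℓ v) *
          t.waveFun (some (w', n')) i := by
      intro i _
      by_cases hi : w' <+: i
      · congr 2
        rw [cov]
        congr 1
        apply Finset.filter_congr
        intro v _
        refine and_congr_right fun hvj => ⟨fun hvi => ?_, fun hv => hv.trans hi⟩
        rcases List.prefix_or_prefix_of_prefix hvi hi with h | h
        · exact h
        · rcases List.prefix_or_prefix_of_prefix hj (h.trans hvj) with h | h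
          · exact absurd h h1
          · exact absurd h h2
      · rw [waveFun_eq_zero t hi]; simp
    rw [Finset.sum_congr rfl this, ← Finset.mul_sum, sum_waveFun, mul_zero]
  · simp [waveFun_eq_zero t hj]

/-- Internal path length plus number of internal nodes. -/
noncomputable def pathLen (t : KTree k) : ℝ := ∑ w ∈ t.intPos, ((w.length : ℝ) + 1)

theorem card_prefix_pairs (t : KTree k) :
    (((t.intPos ×ˢ t.intPos).filter fun p => p.1 <+: p.2).card : ℝ) ≤ t.pathLen := by
  have h : ((t.intPos ×ˢ t.intPos).filter fun p => p.1 <+: p.2) ⊆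
      t.intPos.biUnion fun w => (w.inits.toFinset).image fun v => (v, w) := by
    intro p hp
    simp only [Finset.mem_filter, Finset.mem_product] at hp
    simp only [Finset.mem_biUnion, Finset.mem_image, List.mem_toFinset, List.mem_inits]
    exact ⟨p.2, hp.1.2, p.1, hp.2, rfl⟩
  have h2 : ((t.intPos ×ˢ t.intPos).filter fun p => p.1 <+: p.2).card ≤
      ∑ w ∈ t.intPos, (w.length + 1) := by
    refine (Finset.card_le_card h).trans (Finset.card_biUnion_le.trans ?_)
    refine Finset.sum_le_sum fun w _ => ?_
    refine Finset.card_image_le.trans ((List.toFinset_card_le _).trans ?_)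
    simp
  rw [pathLen]
  exact_mod_cast h2

theorem card_nonzero (hk : 2 ≤ k) (t : KTree k) (ℓ : List (Fin k) → ℝ)
    [DecidablePred fun p : Option (List (Fin k) × ℕ) × Option (List (Fin k) × ℕ) =>
      ¬ t.entry ℓ p.1 p.2 = 0] :
    (((t.waveletIdx ×ˢ t.waveletIdx).filter fun p => ¬ t.entry ℓ p.1 p.2 = 0).card : ℝ) ≤
      2 * t.leafPos.card + 2 * ((k : ℝ) - 1) ^ 2 * t.pathLen := by
  classical
  set A := (t.intPos ×ˢ t.intPos).filter fun p => p.1 <+: p.2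
  set B := A ×ˢ (Finset.Ico 1 k ×ˢ Finset.Ico 1 k)
  let F : (List (Fin k) × List (Fin k)) × (ℕ × ℕ) →
    Option (List (Fin k) × ℕ) × Option (List (Fin k) × ℕ) :=
    fun q => (some (q.1.1, q.2.1), some (q.1.2, q.2.2))
  let G : (List (Fin k) × List (Fin k)) × (ℕ × ℕ) →
    Option (List (Fin k) × ℕ) × Option (List (Fin k) × ℕ) :=
    fun q => (some (q.1.2, q.2.1), some (q.1.1, q.2.2))
  have hsub : ((t.waveletIdx ×ˢ t.waveletIdx).filter fun p => ¬ t.entry ℓ p.1 p.2 = 0) ⊆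
      (t.waveletIdx.image (fun a => (none, a)) ∪ t.waveletIdx.image (fun a => (a, none))) ∪
        (B.image F ∪ B.image G) := by
    rintro ⟨a, b⟩ hp
    simp only [Finset.mem_filter, Finset.mem_product] at hp
    obtain ⟨⟨ha, hb⟩, hne⟩ := hp
    rcases a with _ | ⟨w, n⟩
    · apply Finset.mem_union_left; apply Finset.mem_union_left
      exact Finset.mem_image.2 ⟨b, hb, rfl⟩
    rcases b with _ | ⟨w', n'⟩
    · apply Finset.mem_union_left; apply Finset.mem_union_right
      exact Finset.mem_image.2 ⟨_, ha, rfl⟩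
    apply Finset.mem_union_right
    simp only [waveletIdx, Finset.mem_insert, Finset.mem_image, Finset.mem_product,
      Option.some.injEq, exists_eq_right, reduceCtorEq, false_or] at ha hb
    by_cases h1 : w <+: w'
    · apply Finset.mem_union_left
      refine Finset.mem_image.2 ⟨((w, w'), (n, n')), ?_, rfl⟩
      simp only [B, A, Finset.mem_product, Finset.mem_filter]
      exact ⟨⟨⟨ha.1, hb.1⟩, h1⟩, ha.2, hb.2⟩
    · by_cases h2 : w' <+: w
      · apply Finset.mem_union_right
        refine Finset.mem_image.2 ⟨((w', w), (n, n')), ?_, rfl⟩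
        simp only [B, A, Finset.mem_product, Finset.mem_filter]
        exact ⟨⟨⟨hb.1, ha.1⟩, h2⟩, ha.2, hb.2⟩
      · exact absurd (entry_eq_zero t ℓ w w' n n' h1 h2) hne
  have hc : ((t.waveletIdx ×ˢ t.waveletIdx).filter fun p => ¬ t.entry ℓ p.1 p.2 = 0).card ≤
      (t.waveletIdx.card + t.waveletIdx.card) + (B.card + B.card) := by
    refine (Finset.card_le_card hsub).trans ((Finset.card_union_le _ _).trans ?_)
    refine add_le_add ((Finset.card_union_le _ _).trans ?_)
      ((Finset.card_union_le _ _).trans ?_) <;>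
    exact add_le_add Finset.card_image_le Finset.card_image_le
  have hB : (B.card : ℝ) = A.card * ((k : ℝ) - 1) ^ 2 := by
    simp only [B, Finset.card_product, Nat.card_Ico]
    push_cast [Nat.cast_sub (show 1 ≤ k by omega)]
    ring
  have hA : (A.card : ℝ) ≤ t.pathLen := card_prefix_pairs t
  have hc' : (((t.waveletIdx ×ˢ t.waveletIdx).filter
      fun p => ¬ t.entry ℓ p.1 p.2 = 0).card : ℝ) ≤
      (t.waveletIdx.card + t.waveletIdx.card) + (B.card + B.card) := by exact_mod_cast hc
  rw [card_waveletIdx hk, hB] at hc'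
  have := mul_le_mul_of_nonneg_right hA (sq_nonneg ((k : ℝ) - 1))
  linarith

theorem numNodes_le_pathLen (t : KTree k) : (t.numNodes : ℝ) ≤ t.pathLen := by
  rw [← card_intPos, pathLen]
  have : ((t.intPos.card : ℕ) : ℝ) = ∑ w ∈ t.intPos, (1 : ℝ) := by simp
  rw [this]
  refine Finset.sum_le_sum fun w _ => ?_
  have : (0 : ℝ) ≤ w.length := Nat.cast_nonneg _
  linarith

theorem one_sub_zeta_le (hk : 2 ≤ k) (t : KTree k) (ℓ : List (Fin k) → ℝ)
    (hN : 1 ≤ t.numNodes) :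
    (1 - t.zeta ℓ) * (t.numNodes : ℝ) ^ 2 ≤ 4 * t.pathLen := by
  classical
  have h1 := card_nonzero hk t ℓ
  have h2 := Finset.card_filter_add_card_filter_not (s := t.waveletIdx ×ˢ t.waveletIdx)
    (fun p => t.entry ℓ p.1 p.2 = 0)
  have h3 : (((t.waveletIdx ×ˢ t.waveletIdx).filter fun p => t.entry ℓ p.1 p.2 = 0).card : ℝ) +
    (((t.waveletIdx ×ˢ t.waveletIdx).filter fun p => ¬ t.entry ℓ p.1 p.2 = 0).card : ℝ) =
      (t.leafPos.card : ℝ) ^ 2 := by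
    rw [← card_waveletIdx hk, sq]
    exact_mod_cast h2.trans (Finset.card_product _ _)
  have hL := card_leafPos t
  have hNP := numNodes_le_pathLen t
  have hN' : (1 : ℝ) ≤ t.numNodes := by exact_mod_cast hN
  have hk' : (2 : ℝ) ≤ k := by exact_mod_cast hk
  have hz : t.zeta ℓ =
    (((t.waveletIdx ×ˢ t.waveletIdx).filter fun p => t.entry ℓ p.1 p.2 = 0).card : ℝ) /
      (t.leafPos.card : ℝ) ^ 2 := by
    rw [zeta]
  set L : ℝ := (t.leafPos.card : ℝ)
  set N : ℝ := (t.numNodes : ℝ)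
  set Q := t.pathLen
  set z := t.zeta ℓ
  set x : ℝ := (((t.waveletIdx ×ˢ t.waveletIdx).filter fun p => t.entry ℓ p.1 p.2 = 0).card : ℝ)
  have hLN : ((k : ℝ) - 1) * N ≤ L := by linarith
  have hkN : N ≤ ((k : ℝ) - 1) * N := by nlinarith
  have hL0 : 0 < L := by linarith
  have e : (1 - z) * L ^ 2 ≤ 2 * L + 2 * ((k : ℝ) - 1) ^ 2 * Q := by
    rw [hz]
    have : (1 - x / L ^ 2) * L ^ 2 = L ^ 2 - x := by field_simp
    rw [this]; linarith
  have a1 : L * N ^ 2 ≤ L ^ 2 * N := by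
    have : N ≤ L := by linarith
    have := mul_le_mul_of_nonneg_left this (show 0 ≤ L * N by positivity)
    nlinarith
  have a2 : ((k : ℝ) - 1) ^ 2 * N ^ 2 ≤ L ^ 2 := by
    rw [← mul_pow]
    exact pow_le_pow_left₀ (by linarith) hLN 2
  have hQ : 0 ≤ Q := by linarith
  have a3 : ((1 - z) * N ^ 2) * L ^ 2 ≤ (4 * Q) * L ^ 2 := by
    have b1 := mul_le_mul_of_nonneg_right e (sq_nonneg N)
    have b2 := mul_le_mul_of_nonneg_right a2 hQ
    have b3 := mul_le_mul_of_nonneg_left hNP (sq_nonneg L)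
    nlinarith
  exact le_of_mul_le_mul_right a3 (by positivity)

/-! ### Counting part -/

theorem finite_le (k : ℕ) (n : ℕ) : {t : KTree k | t.numNodes ≤ n}.Finite := by
  induction n with
  | zero =>
    refine (Set.finite_singleton (leaf : KTree k)).subset ?_
    intro t ht
    cases t with
    | leaf => rfl
    | node f => simp [numNodes] at ht
  | succ n ih =>
    have h := ((Set.finite_singleton (leaf : KTree k)).union
      ((Set.Finite.pi' (fun _ : Fin k => ih)).image node))
    refine h.subset ?_
    intro t ht
    cases t with
    | leaf => left; rfl
    | node f =>
      right
      refine ⟨f, ?_, rfl⟩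
      intro i
      simp only [Set.mem_ofPred_eq, numNodes] at ht ⊢
      have h2 := Finset.single_le_sum (f := fun i => numNodes (f i))
        (fun _ _ => Nat.zero_le _) (Finset.mem_univ i)
      omega

theorem finite_eq (k : ℕ) (n : ℕ) : {t : KTree k | t.numNodes = n}.Finite :=
  (finite_le k n).subset fun _ h => le_of_eq h

/-- The finset of trees with `n` internal nodes. -/
noncomputable def trees (k n : ℕ) : Finset (KTree k) := (finite_eq k n).toFinset

theorem mem_trees {n : ℕ} {t : KTree k} : t ∈ trees k n ↔ t.numNodes = n := by
  simp [trees]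

open PowerSeries in
/-- The weighted generating function. -/
noncomputable def W (h : KTree k → ℝ) : PowerSeries ℝ :=
  PowerSeries.mk fun n => ∑ t ∈ trees k n, h t

theorem coeff_prod_W (h : Fin k → KTree k → ℝ) (g : KTree k → ℝ)
    (hg : ∀ f, g (node f) = ∏ i, h i (f i)) (n : ℕ) :
    ∑ t ∈ trees k (n + 1), g t = PowerSeries.coeff n (∏ i, W (h i)) := by
  classical
  rw [PowerSeries.coeff_prod]
  simp only [W, PowerSeries.coeff_mk]
  simp only [Finset.prod_univ_sum]
  rw [Finset.sum_sigma']
  symm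
  refine Finset.sum_bij (fun p _ => node p.2) ?_ ?_ ?_ ?_
  · rintro ⟨l, f⟩ hp
    simp only [Finset.mem_sigma, Finset.mem_finsuppAntidiag, Fintype.mem_piFinset,
      mem_trees] at hp ⊢
    rw [numNodes]
    simp only [hp.2, hp.1.1]
    omega
  · rintro ⟨l, f⟩ hp ⟨l', f'⟩ hp' e
    simp only [Finset.mem_sigma, Fintype.mem_piFinset, mem_trees] at hp hp'
    simp only [node.injEq] at e
    subst e
    have : l = l' := by
      ext i
      rw [← hp.2 i, ← hp'.2 i]
    subst this
    rfl
  · intro t ht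
    rw [mem_trees] at ht
    cases t with
    | leaf => simp [numNodes] at ht
    | node f =>
      rw [numNodes] at ht
      refine ⟨⟨Finsupp.equivFunOnFinite.symm fun i => (f i).numNodes, f⟩, ?_, rfl⟩
      simp only [Finset.mem_sigma, Finset.mem_finsuppAntidiag, Fintype.mem_piFinset,
        mem_trees]
      refine ⟨⟨?_, by simp⟩, ?_⟩
      · simp; omega
      · intro i; simp
  · rintro ⟨l, f⟩ _
    exact (hg f).symm

theorem trees_zero (k : ℕ) : trees k 0 = {leaf} := by
  ext t
  rw [mem_trees, Finset.mem_singleton]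
  cases t <;> simp [numNodes]

open PowerSeries in
theorem W_eq (h : Fin k → KTree k → ℝ) (g : KTree k → ℝ)
    (hg : ∀ f, g (node f) = ∏ i, h i (f i)) :
    W g = C (g leaf) + X * ∏ i, W (h i) := by
  ext n
  cases n with
  | zero => simp [W, trees_zero]
  | succ n =>
    rw [map_add, PowerSeries.coeff_succ_X_mul, ← coeff_prod_W h g hg, PowerSeries.coeff_C]
    simp [W]

/-- Generating function of the trees. -/
noncomputable def TT (k : ℕ) : PowerSeries ℝ := W (fun _ : KTree k => 1)

theorem TT_eq (k : ℕ) : TT k = 1 + PowerSeries.X * TT k ^ k := by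
  have h := W_eq (fun (_ : Fin k) (_ : KTree k) => (1 : ℝ)) (fun _ => 1) (by simp)
  simpa [TT] using h

/-- Number of internal nodes at depth `d`. -/
noncomputable def Z (d : ℕ) (t : KTree k) : ℝ := ∑ w ∈ t.intPos, if w.length = d then 1 else 0

theorem W_Z_zero : W (Z 0 : KTree k → ℝ) = PowerSeries.X * TT k ^ k := by
  have h := W_eq (fun (_ : Fin k) (_ : KTree k) => (1 : ℝ)) (Z 0)
    (by intro f; rw [Z, sum_intPos_node]; simp)
  rw [h]
  simp [TT, Z, intPos]

theorem W_sum {ι : Type*} (s : Finset ι) (g : ι → KTree k → ℝ) :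
    W (fun t => ∑ i ∈ s, g i t) = ∑ i ∈ s, W (g i) := by
  ext n
  simp only [W, PowerSeries.coeff_mk, map_sum]
  exact Finset.sum_comm

theorem W_Z_succ (d : ℕ) :
    W (Z (d + 1) : KTree k → ℝ) =
      PowerSeries.C (k : ℝ) * PowerSeries.X * TT k ^ (k - 1) * W (Z d : KTree k → ℝ) := by
  classical
  let g : Fin k → KTree k → ℝ := fun i t => match t with
    | leaf => 0
    | node f => Z d (f i)
  have e : (Z (d + 1) : KTree k → ℝ) = fun t => ∑ i, g i t := by
    funext t
    cases t with
    | leaf => simp [Z, intPos, g]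
    | node f => rw [Z, sum_intPos_node]; simp only [g, Z]; simp
  have h : ∀ i, W (g i) = PowerSeries.X * (W (Z d : KTree k → ℝ) * TT k ^ (k - 1)) := by
    intro i
    rw [W_eq (fun j => if j = i then Z d else fun _ => 1) (g i)]
    · simp only [g, map_zero, zero_add]
      congr 1
      rw [← Finset.mul_prod_erase _ _ (Finset.mem_univ i)]
      congr 1
      · simp
      · rw [Finset.prod_congr rfl (g := fun _ => TT k)]
        · simp
        · intro j hj
          rw [if_neg (Finset.ne_of_mem_erase hj)]
          rfl
    · intro f
      rw [← Finset.mul_prod_erase _ _ (Finset.mem_univ i), Finset.prod_eq_one]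
      · simp [g]
      · intro j hj
        rw [if_neg (Finset.ne_of_mem_erase hj)]
  rw [e, W_sum, Finset.sum_congr rfl (fun i _ => h i)]
  simp
  ring

theorem W_Z (d : ℕ) :
    W (Z d : KTree k → ℝ) =
      PowerSeries.C ((k : ℝ) ^ d) * (TT k ^ ((k - 1) * d + k) * PowerSeries.X ^ (d + 1)) := by
  induction d with
  | zero => rw [W_Z_zero]; simp; ring
  | succ d ih =>
    rw [W_Z_succ, ih]
    simp only [map_pow]
    rw [show (k - 1) * (d + 1) + k = (k - 1) + ((k - 1) * d + k) by ring, pow_add]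
    ring

theorem coeff_TT_pow (hk : 2 ≤ k) (n : ℕ) : ∀ m : ℕ,
    ((k * n + m : ℕ) : ℝ) * PowerSeries.coeff n (TT k ^ m) = m * ((k * n + m).choose n : ℕ) := by
  have hrec : ∀ m, TT k ^ (m + 1) = TT k ^ m + PowerSeries.X * TT k ^ (m + k) := by
    intro m
    rw [pow_succ]
    nth_rewrite 2 [TT_eq]
    rw [pow_add]; ring
  induction n with
  | zero =>
    intro m
    have : PowerSeries.constantCoeff (TT k) = 1 := by rw [TT_eq]; simp
    simp [this]
  | succ n ih =>
    intro m
    induction m with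
    | zero => simp
    | succ m ihm =>
      rw [hrec, map_add, PowerSeries.coeff_succ_X_mul]
      have h1 := ih (m + k)
      set c1 := PowerSeries.coeff (n + 1) (TT k ^ m)
      set c2 := PowerSeries.coeff n (TT k ^ (m + k))
      obtain ⟨N, hN⟩ : ∃ N, N = k * (n + 1) + m := ⟨_, rfl⟩
      have hN1 : k * n + (m + k) = N := by rw [hN]; ring
      have hN2 : k * (n + 1) + (m + 1) = N + 1 := by rw [hN]; ring
      rw [hN1] at h1
      rw [← hN] at ihm
      rw [hN2]
      have hNn : n ≤ N := by rw [hN]; nlinarith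
      have hN0 : 0 < (N : ℝ) := by
        have : 0 < N := by rw [hN]; nlinarith
        exact_mod_cast this
      have hNr : (N : ℝ) = k * (n + 1) + m := by rw [hN]; push_cast; ring
      have q1 := Nat.add_one_mul_choose_eq N n
      have q2 := Nat.choose_succ_right_eq N n
      have q1' : ((N : ℝ) + 1) * ((N.choose n : ℕ) : ℝ) = (((N + 1).choose (n + 1) : ℕ) : ℝ) * ((n : ℝ) + 1) := by
        exact_mod_cast q1
      have q2' : ((N.choose (n + 1) : ℕ) : ℝ) * ((n : ℝ) + 1) = ((N.choose n : ℕ) : ℝ) * ((N : ℝ) - n) := by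
        rw [← Nat.cast_sub hNn]; exact_mod_cast q2
      have hn : (0 : ℝ) < (n : ℝ) + 1 := by positivity
      push_cast at *
      set a : ℝ := ((N.choose n : ℕ) : ℝ)
      set b : ℝ := ((N.choose (n + 1) : ℕ) : ℝ)
      set c : ℝ := (((N + 1).choose (n + 1) : ℕ) : ℝ)
      have goal' : ((N : ℝ) * ((n : ℝ) + 1)) * (((N : ℝ) + 1) * (c1 + c2)) =
          ((N : ℝ) * ((n : ℝ) + 1)) * (((m : ℝ) + 1) * c) := by
        have s1 : ((N : ℝ) * ((n : ℝ) + 1)) * (((N : ℝ) + 1) * (c1 + c2)) =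
          ((N : ℝ) + 1) * ((n + 1) * (N * c1) + (n + 1) * (N * c2)) := by ring
        rw [s1, ihm, h1]
        have s2 : ((n : ℝ) + 1) * (m * b) = m * (a * (N - n)) := by rw [← q2']; ring
        have s3 : ((N : ℝ) * ((n : ℝ) + 1)) * (((m : ℝ) + 1) * c) =
          N * (m + 1) * ((N + 1) * a) := by rw [q1']; ring
        rw [s2, s3, hNr]
        ring
      exact mul_left_cancel₀ (by positivity) goal'

theorem pathLen_eq (t : KTree k) :
    t.pathLen = ∑ d ∈ Finset.range t.numNodes, ((d : ℝ) + 1) * Z d t := by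
  simp only [Z, Finset.mul_sum]
  rw [Finset.sum_comm, pathLen]
  refine Finset.sum_congr rfl fun w hw => ?_
  have := length_lt_numNodes t w hw
  rw [Finset.sum_eq_single w.length]
  · simp
  · intro b _ hb
    simp [hb.symm]
  · intro h
    exact absurd (Finset.mem_range.2 this) h

/-- Majorant for the number of nodes at depth `d`. -/
noncomputable def RR (k n d : ℕ) : ℝ :=
  if d < n then (k : ℝ) ^ d * ((k * n - d).choose (n - 1 - d) : ℕ) else 0

theorem RR_nonneg (k n d : ℕ) : 0 ≤ RR k n d := by
  rw [RR]; split_ifs <;> positivity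

theorem sum_Z (n d : ℕ) (hd : d < n) : ∑ t ∈ trees k n, Z d t =
    (k : ℝ) ^ d * PowerSeries.coeff (n - 1 - d) (TT k ^ ((k - 1) * d + k)) := by
  have h := congrArg (PowerSeries.coeff n) (W_Z (k := k) d)
  rw [PowerSeries.coeff_C_mul, PowerSeries.coeff_mul_X_pow', if_pos (by omega)] at h
  rw [show n - 1 - d = n - (d + 1) by omega, ← h]
  simp [W]

theorem sum_Z_le (hk : 2 ≤ k) (n d : ℕ) (hd : d < n) :
    (n : ℝ) * ∑ t ∈ trees k n, Z d t ≤ ((d : ℝ) + 2) * RR k n d := by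
  rw [sum_Z n d hd, RR, if_pos hd]
  have h := coeff_TT_pow hk (n - 1 - d) ((k - 1) * d + k)
  obtain ⟨e, rfl⟩ : ∃ e, n = d + 1 + e := ⟨n - d - 1, by omega⟩
  obtain ⟨j, rfl⟩ : ∃ j, k = j + 1 := ⟨k - 1, by omega⟩
  have e1 : d + 1 + e - 1 - d = e := by omega
  have e2 : (j + 1) * (d + 1 + e) - d = (j + 1) * e + ((j + 1 - 1) * d + (j + 1)) := by
    have : (j + 1) * (d + 1 + e) = d + ((j + 1) * e + (j * d + (j + 1))) := by ring
    rw [this, Nat.add_sub_cancel_left, Nat.add_sub_cancel]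
  rw [e1] at h ⊢
  rw [e2]
  set N := (j + 1) * e + ((j + 1 - 1) * d + (j + 1)) with hN
  set c := PowerSeries.coeff e (TT (j + 1) ^ ((j + 1 - 1) * d + (j + 1)))
  rw [Nat.add_sub_cancel] at h hN
  have hj : (1 : ℝ) ≤ j := by exact_mod_cast (by omega : 1 ≤ j)
  have hNr : (N : ℝ) = (j + 1) * e + (j * d + (j + 1)) := by rw [hN]; push_cast; ring
  have hN0 : 0 < (N : ℝ) := by rw [hNr]; positivity
  set b : ℝ := ((N.choose e : ℕ) : ℝ) with hb
  have hb0 : 0 ≤ b := by positivity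
  push_cast at h ⊢
  have key : ((d : ℝ) + 1 + e) * c ≤ (d + 2) * b := by
    refine le_of_mul_le_mul_left ?_ hN0
    have : (N : ℝ) * (((d : ℝ) + 1 + e) * c) = ((d : ℝ) + 1 + e) * ((j * d + (j + 1)) * b) := by
      rw [← h]; ring
    rw [this, ← mul_assoc, ← mul_assoc]
    refine mul_le_mul_of_nonneg_right ?_ hb0
    rw [hNr]
    have hd0 : (0 : ℝ) ≤ d := by positivity
    have he0 : (0 : ℝ) ≤ e := by positivity
    have m1 : (j : ℝ) * d + (j + 1) ≤ j * (d + 2) := by nlinarith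
    have m2 : (j : ℝ) * (d + 1 + e) ≤ (j + 1) * e + (j * d + (j + 1)) := by nlinarith
    calc ((d : ℝ) + 1 + e) * (j * d + (j + 1)) ≤ (d + 1 + e) * (j * (d + 2)) := by gcongr
      _ = (j * (d + 1 + e)) * (d + 2) := by ring
      _ ≤ _ := by gcongr
  calc ((d : ℝ) + 1 + e) * (((j : ℝ) + 1) ^ d * c) = ((j : ℝ) + 1) ^ d * ((d + 1 + e) * c) := by
        ring
    _ ≤ ((j : ℝ) + 1) ^ d * ((d + 2) * b) := by gcongr
    _ = _ := by ring

theorem RR_zero (hk : 2 ≤ k) (n : ℕ) (hn : 1 ≤ n) :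
    RR k n 0 = n * ((trees k n).card : ℝ) := by
  obtain ⟨m, rfl⟩ : ∃ m, n = m + 1 := ⟨n - 1, by omega⟩
  have h := coeff_TT_pow hk (m + 1) 1
  have hc : PowerSeries.coeff (m + 1) (TT k ^ 1) = ((trees k (m + 1)).card : ℝ) := by
    simp [TT, W]
  rw [hc] at h
  have q := Nat.add_one_mul_choose_eq (k * (m + 1)) m
  have q' : (((k * (m + 1) + 1 : ℕ)) : ℝ) * ((k * (m + 1)).choose m : ℕ) =
    ((k * (m + 1) + 1).choose (m + 1) : ℕ) * ((m + 1 : ℕ) : ℝ) := by exact_mod_cast q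
  rw [RR, if_pos (by omega)]
  simp only [pow_zero, one_mul, Nat.sub_zero, Nat.add_sub_cancel]
  have h0 : (0 : ℝ) < ((k * (m + 1) + 1 : ℕ) : ℝ) := by positivity
  refine mul_left_cancel₀ h0.ne' ?_
  rw [q']
  rw [Nat.cast_one, one_mul] at h
  rw [← h]
  ring

theorem RR_succ (hk : 2 ≤ k) (n d : ℕ) :
    (d : ℝ) * RR k n d ≤ 2 * n * (RR k n d - RR k n (d + 1)) := by
  rcases lt_or_ge (d + 1) n with hd | hd
  · obtain ⟨e, rfl⟩ : ∃ e, n = d + 2 + e := ⟨n - d - 2, by omega⟩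
    rw [RR, RR, if_pos (by omega), if_pos (by omega)]
    obtain ⟨N, hN⟩ : ∃ N, k * (d + 2 + e) - (d + 1) = N := ⟨_, rfl⟩
    have hge : d + 1 + 1 ≤ k * (d + 2 + e) := by nlinarith
    have hN2 : k * (d + 2 + e) - d = N + 1 := by omega
    have hN3 : k * (d + 2 + e) = N + 1 + d := by omega
    rw [hN, hN2, show d + 2 + e - 1 - d = e + 1 by omega,
      show d + 2 + e - 1 - (d + 1) = e by omega]
    have q := Nat.add_one_mul_choose_eq N e
    have q' : ((N : ℝ) + 1) * ((N.choose e : ℕ) : ℝ) =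
      (((N + 1).choose (e + 1) : ℕ) : ℝ) * ((e : ℝ) + 1) := by exact_mod_cast q
    have hNr : (k : ℝ) * (d + 2 + e) = N + 1 + d := by exact_mod_cast hN3
    set a : ℝ := ((N.choose e : ℕ) : ℝ)
    set b : ℝ := (((N + 1).choose (e + 1) : ℕ) : ℝ) with hb
    have hb0 : 0 ≤ b := by positivity
    have hk' : (2 : ℝ) ≤ k := by exact_mod_cast hk
    have hd0 : (0 : ℝ) ≤ d := by positivity
    have he0 : (0 : ℝ) ≤ e := by positivity
    have hN0 : (0 : ℝ) < (N : ℝ) + 1 := by positivity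
    push_cast
    have key : 2 * ((d : ℝ) + 2 + e) * (k * a) ≤ (2 * (d + 2 + e) - d) * b := by
      refine le_of_mul_le_mul_left ?_ hN0
      have : ((N : ℝ) + 1) * (2 * ((d : ℝ) + 2 + e) * (k * a)) =
          (2 * ((d : ℝ) + 2 + e) * k * (e + 1)) * b := by
        calc _ = 2 * ((d : ℝ) + 2 + e) * k * ((N + 1) * a) := by ring
          _ = _ := by rw [q']; ring
      rw [this, ← mul_assoc]
      refine mul_le_mul_of_nonneg_right ?_ hb0
      have : (N : ℝ) + 1 = k * (d + 2 + e) - d := by linarith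
      rw [this]
      nlinarith [mul_nonneg hd0 he0, mul_nonneg (sub_nonneg.2 hk') (mul_nonneg hd0 he0),
        mul_nonneg (sub_nonneg.2 hk') (mul_nonneg hd0 hd0), mul_nonneg (sub_nonneg.2 hk') hd0,
        mul_nonneg (sub_nonneg.2 hk') he0]
    have hp : (0 : ℝ) ≤ (k : ℝ) ^ d := by positivity
    have := mul_le_mul_of_nonneg_left key hp
    rw [pow_succ]
    nlinarith
  · have : RR k n (d + 1) = 0 := by rw [RR, if_neg (by omega)]
    rw [this, sub_zero]
    rcases lt_or_ge d n with h | h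
    · refine mul_le_mul_of_nonneg_right ?_ (RR_nonneg _ _ _)
      have : (d : ℝ) ≤ n := by exact_mod_cast h.le
      have : (0 : ℝ) ≤ d := by positivity
      linarith
    · have : RR k n d = 0 := by rw [RR, if_neg (by omega)]
      simp [this]

theorem sum_abstract (R : ℕ → ℝ) (n : ℝ) (hn : 1 ≤ n) (hR : ∀ d, 0 ≤ R d)
    (hs : ∀ d : ℕ, (d : ℝ) * R d ≤ 2 * n * (R d - R (d + 1))) (M : ℕ) (hM : 1 ≤ M) (D : ℕ) :
    (M : ℝ) * ∑ d ∈ Finset.range D, ((d : ℝ) + 1) * ((d : ℝ) + 2) * R d ≤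
      (8 * n + 2) * ((M : ℝ) ^ 2 + 2 * n) * R 0 := by
  have hM0 : (0 : ℝ) < M := by exact_mod_cast hM
  have anti : ∀ d, R d ≤ R 0 := by
    intro d
    induction d with
    | zero => exact le_rfl
    | succ d ih =>
      have h1 := hs d
      have h2 : 0 ≤ (d : ℝ) * R d := mul_nonneg (by positivity) (hR d)
      have h3 : 0 ≤ R d - R (d + 1) := by
        by_contra hc
        push Not at hc
        nlinarith
      linarith
  have s1 : ∀ D, ∑ d ∈ Finset.range D, (d : ℝ) * R d ≤ 2 * n * R 0 := by
    intro D
    have : ∀ D, ∑ d ∈ Finset.range D, (d : ℝ) * R d ≤ 2 * n * (R 0 - R D) := by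
      intro D
      induction D with
      | zero => simp
      | succ D ih => rw [Finset.sum_range_succ]; have := hs D; linarith
    have h := this D
    have := hR D
    nlinarith
  have s2 : ∀ D, (M : ℝ) * ∑ d ∈ Finset.range D, R d ≤ ((M : ℝ) ^ 2 + 2 * n) * R 0 := by
    intro D
    have h1 : ∀ d ∈ Finset.range D, (M : ℝ) * R d ≤
        (if d < M then (M : ℝ) * R 0 else 0) + d * R d := by
      intro d _
      split_ifs with h
      · have := mul_le_mul_of_nonneg_left (anti d) hM0.le
        have : 0 ≤ (d : ℝ) * R d := mul_nonneg (by positivity) (hR d)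
        linarith
      · have : (M : ℝ) ≤ d := by exact_mod_cast not_lt.1 h
        have := mul_le_mul_of_nonneg_right this (hR d)
        linarith
    rw [Finset.mul_sum]
    refine (Finset.sum_le_sum h1).trans ?_
    rw [Finset.sum_add_distrib, ← Finset.sum_filter, Finset.sum_const, nsmul_eq_mul]
    have hc : (((Finset.range D).filter fun d => d < M).card : ℝ) ≤ M := by
      have : ((Finset.range D).filter fun d => d < M) ⊆ Finset.range M := by
        intro d hd
        simp only [Finset.mem_filter] at hd
        exact Finset.mem_range.2 hd.2
      have := Finset.card_le_card this
      rw [Finset.card_range] at this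
      exact_mod_cast this
    have := mul_le_mul_of_nonneg_right hc (mul_nonneg hM0.le (hR 0))
    have := s1 D
    nlinarith
  have s3 : ∑ d ∈ Finset.range D, (d : ℝ) ^ 2 * R d ≤ 2 * n * ∑ d ∈ Finset.range (D + 1), R d := by
    have h1 : ∀ D : ℕ, ∑ d ∈ Finset.range D, (d : ℝ) * (R d - R (d + 1)) =
        ∑ d ∈ Finset.range (D + 1), R d - R 0 - D * R D := by
      intro D
      induction D with
      | zero => simp
      | succ D ih =>
        rw [Finset.sum_range_succ, ih, Finset.sum_range_succ _ (D + 1)]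
        push_cast; ring
    have h2 : ∑ d ∈ Finset.range D, (d : ℝ) ^ 2 * R d ≤
        2 * n * ∑ d ∈ Finset.range D, (d : ℝ) * (R d - R (d + 1)) := by
      rw [Finset.mul_sum]
      refine Finset.sum_le_sum fun d _ => ?_
      have := mul_le_mul_of_nonneg_left (hs d) (show (0 : ℝ) ≤ d by positivity)
      nlinarith
    refine h2.trans (mul_le_mul_of_nonneg_left ?_ (by linarith))
    rw [h1]
    have := hR 0
    have : 0 ≤ (D : ℝ) * R D := mul_nonneg (by positivity) (hR D)
    linarith
  have s4 : ∑ d ∈ Finset.range D, ((d : ℝ) + 1) * ((d : ℝ) + 2) * R d ≤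
      4 * ∑ d ∈ Finset.range D, (d : ℝ) ^ 2 * R d + 2 * ∑ d ∈ Finset.range D, R d := by
    rw [Finset.mul_sum, Finset.mul_sum, ← Finset.sum_add_distrib]
    refine Finset.sum_le_sum fun d _ => ?_
    have hdd : (d : ℝ) ≤ (d : ℝ) ^ 2 := by exact_mod_cast Nat.le_self_pow (by norm_num) d
    have := mul_le_mul_of_nonneg_right hdd (hR d)
    nlinarith
  have s5 : ∑ d ∈ Finset.range D, R d ≤ ∑ d ∈ Finset.range (D + 1), R d := by
    rw [Finset.sum_range_succ]; linarith [hR D]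
  have s6 : ∑ d ∈ Finset.range D, ((d : ℝ) + 1) * ((d : ℝ) + 2) * R d ≤
      (8 * n + 2) * ∑ d ∈ Finset.range (D + 1), R d := by linarith
  have := mul_le_mul_of_nonneg_left s6 hM0.le
  have h7 := mul_le_mul_of_nonneg_left (s2 (D + 1)) (show 0 ≤ 8 * n + 2 by linarith)
  linarith

theorem sum_pathLen_le (hk : 2 ≤ k) (n : ℕ) (hn : 1 ≤ n) (M : ℕ) (hM : 1 ≤ M) (hMn : M ^ 2 ≤ n) :
    (M : ℝ) * ∑ t ∈ trees k n, t.pathLen ≤ 30 * (n : ℝ) ^ 2 * (trees k n).card := by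
  have hn' : (1 : ℝ) ≤ n := by exact_mod_cast hn
  have h1 : ∑ t ∈ trees k n, t.pathLen =
      ∑ d ∈ Finset.range n, ((d : ℝ) + 1) * ∑ t ∈ trees k n, Z d t := by
    simp only [Finset.mul_sum]
    rw [Finset.sum_comm]
    refine Finset.sum_congr rfl fun t ht => ?_
    rw [pathLen_eq, mem_trees.1 ht]
  have h2 : (n : ℝ) * ∑ t ∈ trees k n, t.pathLen ≤
      ∑ d ∈ Finset.range n, ((d : ℝ) + 1) * ((d : ℝ) + 2) * RR k n d := by
    rw [h1, Finset.mul_sum]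
    refine Finset.sum_le_sum fun d hd => ?_
    have := mul_le_mul_of_nonneg_left (sum_Z_le hk n d (Finset.mem_range.1 hd))
      (show (0 : ℝ) ≤ (d : ℝ) + 1 by positivity)
    linarith
  have h3 := sum_abstract (RR k n) n hn' (RR_nonneg k n) (RR_succ hk n) M hM n
  rw [RR_zero hk n hn] at h3
  have hM2 : (M : ℝ) ^ 2 ≤ n := by exact_mod_cast hMn
  set c : ℝ := ((trees k n).card : ℝ) with hc
  have hc0 : 0 ≤ c := by positivity
  have hM0 : (0 : ℝ) ≤ M := by positivity
  refine le_of_mul_le_mul_left ?_ (show (0 : ℝ) < n by linarith)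
  have h4 := mul_le_mul_of_nonneg_left h2 hM0
  have h5 : (8 * (n : ℝ) + 2) * ((M : ℝ) ^ 2 + 2 * n) ≤ (10 * n) * (3 * n) := by
    apply mul_le_mul <;> first | positivity | linarith
  have h6 := mul_le_mul_of_nonneg_right h5 (show 0 ≤ (n : ℝ) * c by positivity)
  nlinarith

end KTree

open Filter KTree in
/-- For `T_n` uniform over `k`-regular trees with `n`
interior nodes, each equipped with an arbitrary (positive) edge length
function, the fraction `ζ_n` of vanishing entries of `Φ_n' C_n Φ_n` tends to
`1` in probability: `P(ζ_n ≤ 1 - ε) → 0` for every `ε > 0`. -/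
theorem zeta_tendsto_one_in_probability (k : ℕ) (hk : 2 ≤ k)
    (ℓ : ℕ → KTree k → List (Fin k) → ℝ)
    (hℓ : ∀ n : ℕ, ∀ t : KTree k, ∀ w ∈ t.allPos, 0 < ℓ n t w) :
    ∀ ε : ℝ, 0 < ε →
      Tendsto
        (fun n =>
          (Nat.card {t : KTree k | t.numNodes = n - 1 ∧ t.zeta (ℓ n t) ≤ 1 - ε} : ℝ) /
            (Nat.card {t : KTree k | t.numNodes = n - 1} : ℝ))
        atTop (nhds 0) := by
  classical
  intro ε hε
  have hsqrt : Tendsto (fun n : ℕ => Nat.sqrt (n - 1)) atTop atTop := by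
    refine tendsto_atTop.2 fun b => ?_
    filter_upwards [eventually_ge_atTop (b * b + 1)] with n hn
    exact Nat.le_sqrt.2 (by omega)
  have hlim : Tendsto (fun n : ℕ => (120 / ε) / ((Nat.sqrt (n - 1) : ℕ) : ℝ)) atTop (nhds 0) :=
    (tendsto_const_div_atTop_nhds_zero_nat (120 / ε)).comp hsqrt
  refine squeeze_zero' (Eventually.of_forall fun n => by positivity) ?_ hlim
  filter_upwards [eventually_ge_atTop 2] with n hn
  set N := n - 1 with hN
  have hN1 : 1 ≤ N := by omega
  set M := Nat.sqrt N with hMdef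
  have hM1 : 1 ≤ M := Nat.le_sqrt.2 (by omega)
  have hMN : M ^ 2 ≤ N := Nat.sqrt_le' N
  have hM0 : (0 : ℝ) < M := by exact_mod_cast hM1
  have hN0 : (0 : ℝ) < N := by exact_mod_cast hN1
  have c1 : Nat.card {t : KTree k | t.numNodes = N} = (trees k N).card := by
    rw [Nat.card_coe_set_eq, trees, Set.ncard_eq_toFinset_card _ (finite_eq k N)]
  set B := (trees k N).filter fun t => t.zeta (ℓ n t) ≤ 1 - ε with hB
  have c2 : Nat.card {t : KTree k | t.numNodes = N ∧ t.zeta (ℓ n t) ≤ 1 - ε} = B.card := by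
    rw [Nat.card_coe_set_eq, ← Set.ncard_coe_finset]
    congr 1
    ext t
    simp [hB, mem_trees]
  rw [c1, c2]
  have m1 : (B.card : ℝ) * (ε * (N : ℝ) ^ 2) ≤ 4 * ∑ t ∈ trees k N, t.pathLen := by
    have : ∑ t ∈ B, 4 * t.pathLen ≤ ∑ t ∈ trees k N, 4 * t.pathLen := by
      refine Finset.sum_le_sum_of_subset_of_nonneg (Finset.filter_subset _ _) fun t _ _ => ?_
      have := numNodes_le_pathLen t
      have : (0 : ℝ) ≤ t.numNodes := by positivity
      linarith
    rw [Finset.mul_sum]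
    refine le_trans ?_ this
    rw [← nsmul_eq_mul]
    refine Finset.card_nsmul_le_sum _ _ _ fun t ht => ?_
    rw [hB, Finset.mem_filter, mem_trees] at ht
    have h := one_sub_zeta_le hk t (ℓ n t) (by omega)
    rw [ht.1] at h
    refine le_trans (mul_le_mul_of_nonneg_right ?_ (sq_nonneg _)) h
    linarith [ht.2]
  have m2 := sum_pathLen_le hk N hN1 M hM1 hMN
  have m3 : (B.card : ℝ) * (ε * M) ≤ 120 * (trees k N).card := by
    refine le_of_mul_le_mul_right ?_ (show (0 : ℝ) < (N : ℝ) ^ 2 by positivity)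
    have := mul_le_mul_of_nonneg_right m1 hM0.le
    nlinarith
  rcases (Nat.cast_nonneg (α := ℝ) (trees k N).card).eq_or_lt with h0 | h0
  · rw [← h0]; simp; positivity
  · rw [div_div, div_le_div_iff₀ h0 (by positivity)]
    exact m3
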